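/- Let f : M → ℝ³ be an immersed surface in ℝ³ with an admissible norm, endowed with a Birkhoff normal field η and induced affine fundamental form h. If at a point p ∈ M the rank of h is 0, then dη_p = 0 on T_pM. If at p ∈ M the rank of h equals 1, then dη_p : T_pM → T_pM has two linearly independent eigenvectors, and one of them is associated with the eigenvalue 0. -/

import Mathlib

/-!
Differential geometry of immersed surfaces in three-dimensional normed
(Minkowski) spaces, following Balestro–Martini–Teixeira.

`E3 = ℝ³` carries its standard Euclidean inner product and, in addition, a
norm `N` which is strictly convex and smooth.  Surfaces are given in a local
parametrization `f : P2 → E3` (an immersion on an open set `U`), endowed with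
a Birkhoff normal field `η`.
-/

noncomputable section

open scoped InnerProductSpace

abbrev E3 := EuclideanSpace ℝ (Fin 3)
abbrev P2 := EuclideanSpace ℝ (Fin 2)

/-- A smooth, strictly convex norm on `ℝ³` (a Minkowski norm). -/
structure MinkowskiNorm3 where
  N : E3 → ℝ
  nonneg : ∀ x, 0 ≤ N x
  eq_zero_iff : ∀ x, N x = 0 ↔ x = 0
  smul_eq : ∀ (c : ℝ) (x : E3), N (c • x) = |c| * N x
  triangle : ∀ x y, N (x + y) ≤ N x + N y
  strict_triangle : ∀ x y : E3, LinearIndependent ℝ ![x, y] → N (x + y) < N x + N y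
  smooth : ContDiffOn ℝ (⊤ : ℕ∞) N {x : E3 | x ≠ 0}

namespace MinkowskiNorm3

/-- Birkhoff orthogonality of a vector `v` to a set (e.g. a plane) `H`:
`‖v + w‖ ≥ ‖v‖` for all `w ∈ H`. -/
def BirkhoffOrth (m : MinkowskiNorm3) (v : E3) (H : Set E3) : Prop :=
  ∀ w ∈ H, m.N v ≤ m.N (v + w)

/-- The (outward) Euclidean Gauss map of the unit sphere `∂B` of the norm,
expressed on ambient space as the normalized gradient of `N`.  Restricted to
`∂B` it is the map `u⁻¹ : ∂B → ∂B_e`, whose inverse is `u : ∂B_e → ∂B`. -/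
def sphereGauss (m : MinkowskiNorm3) (v : E3) : E3 :=
  ‖gradient m.N v‖⁻¹ • gradient m.N v

/-- The differential `du⁻¹` at a point `v ∈ ∂B`, applied to a vector `w`
(its restriction to the tangent plane of `∂B` at `v` is the inverse of
`du_{u⁻¹(v)}`). -/
def duInv (m : MinkowskiNorm3) (v w : E3) : E3 :=
  fderiv ℝ m.sphereGauss v w

/-- Admissibility of the norm: the unit sphere `∂B` has positive Euclidean
Gaussian curvature at every point; equivalently, the second fundamental form
of `∂B` with respect to the outward normal is positive definite, i.e.
`⟪du⁻¹ w, w⟫ > 0` for every nonzero vector `w` tangent to `∂B`. -/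
def Admissible (m : MinkowskiNorm3) : Prop :=
  ∀ v : E3, m.N v = 1 → ∀ w : E3, w ≠ 0 → fderiv ℝ m.N v w = 0 →
    0 < ⟪m.duInv v w, w⟫_ℝ

end MinkowskiNorm3

/-- An immersed surface (in a local parametrization on an open set `U ⊆ ℝ²`)
in the Minkowski space `(ℝ³, m)`, endowed with a Birkhoff normal vector
field `η`: a smooth unit field with `η(p) ⊣_B T_pM` for all `p`. -/
structure BSurface (m : MinkowskiNorm3) where
  U : Set P2
  isOpen : IsOpen U
  f : P2 → E3
  smooth_f : ContDiffOn ℝ (⊤ : ℕ∞) f U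
  immersion : ∀ p ∈ U, Function.Injective (fderiv ℝ f p)
  η : P2 → E3
  smooth_η : ContDiffOn ℝ (⊤ : ℕ∞) η U
  unit_η : ∀ p ∈ U, m.N (η p) = 1
  birkhoff : ∀ p ∈ U, m.BirkhoffOrth (η p) (Set.range (fderiv ℝ f p))

namespace BSurface

variable {m : MinkowskiNorm3}

/-- The tangent plane `T_pM`, identified (via the push-forward `df_p`) with a
linear plane in ambient `ℝ³`. -/
def tangent (S : BSurface m) (p : P2) : Set E3 := Set.range (fderiv ℝ S.f p)

/-- `h : P2 → P2 → ℝ` (in the parameter coordinates, i.e. `h v w` stands for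
`h(df_p v, df_p w)`) is the affine fundamental form of the immersion at `p`,
determined by the Gauss formula `D_X Y = ∇_X Y + h(X,Y) η`: for coordinate
directions `v, w`, the second derivative `D_v D_w f` minus `h v w • η p` is
tangential. -/
def IsAffineFundForm (S : BSurface m) (p : P2) (h : P2 → P2 → ℝ) : Prop :=
  ∀ v w : P2,
    fderiv ℝ (fun q => fderiv ℝ S.f q w) p v - h v w • S.η p ∈ S.tangent p

end BSurface

/-- The Minkowski normal curvature of the surface parametrized by `f` with
Birkhoff normal field `η`, at `p`, in the tangent direction `X = df_p v`:
`k_{M,p}(X) = ⟪du⁻¹_{η(p)} X, dη_p X⟫ / ⟪du⁻¹_{η(p)} X, X⟫`, using the natural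
identification of the parallel planes `T_pM ≅ T_{η(p)}∂B ≅ T_{ξ(p)}∂B_e`. -/
def normalCurv (m : MinkowskiNorm3) (f η : P2 → E3) (p v : P2) : ℝ :=
  ⟪m.duInv (η p) (fderiv ℝ f p v), fderiv ℝ η p v⟫_ℝ /
    ⟪m.duInv (η p) (fderiv ℝ f p v), fderiv ℝ f p v⟫_ℝ

namespace MinkowskiNorm3

lemma contDiffAt_N (m : MinkowskiNorm3) {v : E3} (hv : v ≠ 0) :
    ContDiffAt ℝ (⊤ : ℕ∞) m.N v :=
  m.smooth.contDiffAt (isOpen_ne.mem_nhds hv)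

lemma ne_zero_of_N_eq_one (m : MinkowskiNorm3) {v : E3} (hv : m.N v = 1) : v ≠ 0 := by
  rintro rfl
  rw [(m.eq_zero_iff 0).2 rfl] at hv
  exact zero_ne_one hv

lemma differentiableAt_N (m : MinkowskiNorm3) {v : E3} (hv : v ≠ 0) :
    DifferentiableAt ℝ m.N v :=
  (m.contDiffAt_N hv).differentiableAt (by simp)

lemma differentiableAt_fderiv_N (m : MinkowskiNorm3) {v : E3} (hv : v ≠ 0) :
    DifferentiableAt ℝ (fderiv ℝ m.N) v :=
  ((m.contDiffAt_N hv).fderiv_right (m := 1) (by norm_cast)).differentiableAt (by simp)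

/-- Euler's identity for the `1`-homogeneous function `N`. -/
lemma fderiv_N_self (m : MinkowskiNorm3) {v : E3} (hv : v ≠ 0) :
    fderiv ℝ m.N v v = m.N v := by
  have hc : HasDerivAt (fun t : ℝ => t • v) v 1 := by
    simpa using (hasDerivAt_id (1 : ℝ)).smul_const v
  have h1 : HasDerivAt (fun t : ℝ => m.N (t • v)) (fderiv ℝ m.N v v) 1 := by
    have hN : HasFDerivAt m.N (fderiv ℝ m.N v) ((1 : ℝ) • v) := by
      simpa using (m.differentiableAt_N hv).hasFDerivAt
    exact hN.comp_hasDerivAt 1 hc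
  have h2 : HasDerivAt (fun t : ℝ => m.N (t • v)) (m.N v) 1 := by
    have h3 : HasDerivAt (fun t : ℝ => t * m.N v) (m.N v) 1 := by
      simpa using (hasDerivAt_id (1 : ℝ)).mul_const (m.N v)
    refine h3.congr_of_eventuallyEq ?_
    filter_upwards [lt_mem_nhds (zero_lt_one : (0 : ℝ) < 1)] with t ht
    rw [m.smul_eq, abs_of_pos ht]
  exact h1.unique h2

/-- If `v` is Birkhoff orthogonal to the range of a linear map, then that range is tangent to the
sphere of the norm at `v`. -/
lemma fderiv_N_eq_zero_of_birkhoffOrth (m : MinkowskiNorm3) {v : E3} (hv : v ≠ 0)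
    (L : P2 →L[ℝ] E3) (h : m.BirkhoffOrth v (Set.range L)) (w : P2) :
    fderiv ℝ m.N v (L w) = 0 := by
  have hc : HasDerivAt (fun t : ℝ => v + t • L w) (L w) 0 := by
    simpa using ((hasDerivAt_id (0 : ℝ)).smul_const (L w)).const_add v
  have h1 : HasDerivAt (fun t : ℝ => m.N (v + t • L w)) (fderiv ℝ m.N v (L w)) 0 := by
    have hN : HasFDerivAt m.N (fderiv ℝ m.N v) (v + (0 : ℝ) • L w) := by
      simpa using (m.differentiableAt_N hv).hasFDerivAt
    exact hN.comp_hasDerivAt 0 hc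
  refine IsLocalMin.hasDerivAt_eq_zero (Filter.Eventually.of_forall fun t => ?_) h1
  simpa using h (t • L w) ⟨t • w, by simp⟩

lemma hessian_symm (m : MinkowskiNorm3) {v : E3} (hv : v ≠ 0) (x y : E3) :
    fderiv ℝ (fderiv ℝ m.N) v x y = fderiv ℝ (fderiv ℝ m.N) v y x :=
  (m.contDiffAt_N hv).isSymmSndFDerivAt (by simp; norm_cast) x y

lemma inner_gradient_N (m : MinkowskiNorm3) (v w : E3) :
    ⟪gradient m.N v, w⟫_ℝ = fderiv ℝ m.N v w := by
  simp [gradient]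

/-- On the tangent plane of the unit sphere, the second fundamental form is a multiple of the
Hessian of the norm. -/
lemma inner_duInv (m : MinkowskiNorm3) {v : E3} (hv : m.N v = 1) {w : E3}
    (hw : fderiv ℝ m.N v w = 0) :
    ⟪m.duInv v w, w⟫_ℝ = ‖gradient m.N v‖⁻¹ * fderiv ℝ (fderiv ℝ m.N) v w w := by
  have hv0 := m.ne_zero_of_N_eq_one hv
  have hd := m.differentiableAt_fderiv_N hv0
  have hg : DifferentiableAt ℝ (gradient m.N) v :=
    (InnerProductSpace.toDual ℝ E3).symm.toContinuousLinearEquiv.differentiableAt.comp v hd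
  have hg0 : gradient m.N v ≠ 0 := by
    intro h0
    have := m.inner_gradient_N v v
    rw [h0, m.fderiv_N_self hv0, hv] at this
    simp at this
  have hr : DifferentiableAt ℝ (fun x => ‖gradient m.N x‖⁻¹) v :=
    (hg.norm ℝ hg0).inv (norm_ne_zero_iff.2 hg0)
  have hG : DifferentiableAt ℝ m.sphereGauss v := hr.smul hg
  have h1 : HasFDerivAt (fun x => ⟪m.sphereGauss x, w⟫_ℝ) _ v :=
    hG.hasFDerivAt.inner ℝ (hasFDerivAt_const w v)
  have h2 : HasFDerivAt (fun x => ‖gradient m.N x‖⁻¹ * fderiv ℝ m.N x w) _ v :=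
    hr.hasFDerivAt.mul (hd.hasFDerivAt.clm_apply (hasFDerivAt_const w v))
  have he : (fun x => ⟪m.sphereGauss x, w⟫_ℝ) =
      fun x => ‖gradient m.N x‖⁻¹ * fderiv ℝ m.N x w := by
    funext x
    rw [sphereGauss, real_inner_smul_left, inner_gradient_N]
  rw [he] at h1
  have h3 := congrArg (fun L => L w) (h1.unique h2)
  simpa [hw, duInv] using h3

lemma Admissible.hessian_pos {m : MinkowskiNorm3} (hadm : m.Admissible) {v : E3} (hv : m.N v = 1)
    {w : E3} (hw0 : w ≠ 0) (hw : fderiv ℝ m.N v w = 0) :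
    0 < fderiv ℝ (fderiv ℝ m.N) v w w := by
  have h := hadm v hv w hw0 hw
  rw [m.inner_duInv hv hw] at h
  exact pos_of_mul_pos_right h (by positivity)

end MinkowskiNorm3

namespace BSurface

variable {m : MinkowskiNorm3} (S : BSurface m) {p : P2}

lemma η_ne_zero (hp : p ∈ S.U) : S.η p ≠ 0 := m.ne_zero_of_N_eq_one (S.unit_η p hp)

lemma differentiableAt_η (hp : p ∈ S.U) : DifferentiableAt ℝ S.η p :=
  (S.smooth_η.contDiffAt (S.isOpen.mem_nhds hp)).differentiableAt (by simp)

lemma contDiffAt_f (hp : p ∈ S.U) : ContDiffAt ℝ (⊤ : ℕ∞) S.f p :=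
  S.smooth_f.contDiffAt (S.isOpen.mem_nhds hp)

lemma differentiableAt_fderiv_f (hp : p ∈ S.U) : DifferentiableAt ℝ (fderiv ℝ S.f) p :=
  ((S.contDiffAt_f hp).fderiv_right (m := 1) (by norm_cast)).differentiableAt (by simp)

lemma fderiv_N_tangent (hp : p ∈ S.U) (w : P2) :
    fderiv ℝ m.N (S.η p) (fderiv ℝ S.f p w) = 0 :=
  m.fderiv_N_eq_zero_of_birkhoffOrth (S.η_ne_zero hp) _ (S.birkhoff p hp) w

lemma fderiv_N_fderiv_η (hp : p ∈ S.U) (v : P2) :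
    fderiv ℝ m.N (S.η p) (fderiv ℝ S.η p v) = 0 := by
  have h1 := (m.differentiableAt_N (S.η_ne_zero hp)).hasFDerivAt.comp p
    (S.differentiableAt_η hp).hasFDerivAt
  have h2 : HasFDerivAt (m.N ∘ S.η) (0 : P2 →L[ℝ] ℝ) p := by
    refine (hasFDerivAt_const (1 : ℝ) p).congr_of_eventuallyEq ?_
    filter_upwards [S.isOpen.mem_nhds hp] with q hq using S.unit_η q hq
  exact congrArg (fun L => L v) (h1.unique h2)

lemma range_fderiv_f (hp : p ∈ S.U) :
    (fderiv ℝ S.f p : P2 →ₗ[ℝ] E3).range = (fderiv ℝ m.N (S.η p) : E3 →ₗ[ℝ] ℝ).ker := by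
  refine Submodule.eq_of_le_of_finrank_le ?_ ?_
  · rintro _ ⟨w, rfl⟩
    exact S.fderiv_N_tangent hp w
  · have h1 : Module.finrank ℝ (fderiv ℝ S.f p : P2 →ₗ[ℝ] E3).range = 2 := by
      rw [LinearMap.finrank_range_of_inj (S.immersion p hp)]
      simp
    have h2 : (fderiv ℝ m.N (S.η p) : E3 →ₗ[ℝ] ℝ).range = ⊤ := by
      refine LinearMap.range_eq_top.2 (LinearMap.surjective fun h0 => ?_)
      have h := m.fderiv_N_self (S.η_ne_zero hp)
      rw [S.unit_η p hp] at h
      have h' := congrArg (fun L : E3 →ₗ[ℝ] ℝ => L (S.η p)) h0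
      exact one_ne_zero (h.symm.trans h')
    have h3 := LinearMap.finrank_range_add_finrank_ker (fderiv ℝ m.N (S.η p) : E3 →ₗ[ℝ] ℝ)
    rw [h2, finrank_top] at h3
    simp at h3
    omega

lemma exists_fderiv_η_eq (hp : p ∈ S.U) (v : P2) :
    ∃ u, fderiv ℝ S.η p v = fderiv ℝ S.f p u := by
  have h : fderiv ℝ S.η p v ∈ (fderiv ℝ S.f p : P2 →ₗ[ℝ] E3).range := by
    rw [S.range_fderiv_f hp]
    exact S.fderiv_N_fderiv_η hp v
  obtain ⟨u, hu⟩ := h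
  exact ⟨u, hu.symm⟩

lemma fderiv_fderiv_apply (hp : p ∈ S.U) (v w : P2) :
    fderiv ℝ (fun q => fderiv ℝ S.f q w) p v = fderiv ℝ (fderiv ℝ S.f) p v w := by
  rw [((S.differentiableAt_fderiv_f hp).hasFDerivAt.clm_apply (hasFDerivAt_const w p)).fderiv]
  simp

/-- The derivative of the relation `DN(η)(df w) = 0`. -/
lemma hessian_fderiv_η (hp : p ∈ S.U) (v w : P2) :
    fderiv ℝ (fderiv ℝ m.N) (S.η p) (fderiv ℝ S.η p v) (fderiv ℝ S.f p w) =
      -fderiv ℝ m.N (S.η p) (fderiv ℝ (fderiv ℝ S.f) p v w) := by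
  have h1 := ((m.differentiableAt_fderiv_N (S.η_ne_zero hp)).hasFDerivAt.comp p
    (S.differentiableAt_η hp).hasFDerivAt).clm_apply
      ((S.differentiableAt_fderiv_f hp).hasFDerivAt.clm_apply (hasFDerivAt_const w p))
  have h2 : HasFDerivAt (fun q => (fderiv ℝ m.N ∘ S.η) q (fderiv ℝ S.f q w))
      (0 : P2 →L[ℝ] ℝ) p := by
    refine (hasFDerivAt_const (0 : ℝ) p).congr_of_eventuallyEq ?_
    filter_upwards [S.isOpen.mem_nhds hp] with q hq using S.fderiv_N_tangent hq w
  have h3 := congrArg (fun L => L v) (h1.unique h2)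
  simp at h3
  linarith

/-- `dη` is self-adjoint for the Hessian of the norm. -/
lemma hessian_fderiv_η_comm (hp : p ∈ S.U) (v w : P2) :
    fderiv ℝ (fderiv ℝ m.N) (S.η p) (fderiv ℝ S.η p v) (fderiv ℝ S.f p w) =
      fderiv ℝ (fderiv ℝ m.N) (S.η p) (fderiv ℝ S.η p w) (fderiv ℝ S.f p v) := by
  rw [S.hessian_fderiv_η hp, S.hessian_fderiv_η hp,
    (S.contDiffAt_f hp).isSymmSndFDerivAt (by simp; norm_cast) v w]

lemma IsAffineFundForm.hessian_eq {S : BSurface m} {h : P2 → P2 → ℝ} (hh : S.IsAffineFundForm p h)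
    (hp : p ∈ S.U) (v w : P2) :
    fderiv ℝ (fderiv ℝ m.N) (S.η p) (fderiv ℝ S.η p v) (fderiv ℝ S.f p w) = -h v w := by
  obtain ⟨u, hu⟩ := hh v w
  have h1 := S.fderiv_N_tangent hp u
  rw [hu, S.fderiv_fderiv_apply hp, map_sub, map_smul, m.fderiv_N_self (S.η_ne_zero hp),
    S.unit_η p hp, smul_eq_mul, mul_one, sub_eq_zero] at h1
  rw [S.hessian_fderiv_η hp, h1]

lemma IsAffineFundForm.fderiv_η_eq_zero {S : BSurface m} {h : P2 → P2 → ℝ}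
    (hh : S.IsAffineFundForm p h) (hadm : m.Admissible) (hp : p ∈ S.U) {v : P2}
    (hv : ∀ w, h v w = 0) : fderiv ℝ S.η p v = 0 := by
  by_contra hne
  have hpos := hadm.hessian_pos (S.unit_η p hp) hne (S.fderiv_N_fderiv_η hp v)
  obtain ⟨u, hu⟩ := S.exists_fderiv_η_eq hp v
  have h1 := hh.hessian_eq hp v u
  rw [← hu, hv u, neg_zero] at h1
  exact hpos.ne' h1

/-- A vector in the kernel of `dη` can be completed to a basis of eigenvectors. -/
lemma exists_eigenvector (hadm : m.Admissible) (hp : p ∈ S.U) {v₁ : P2} (hv₁ : v₁ ≠ 0)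
    (hη : fderiv ℝ S.η p v₁ = 0) :
    ∃ v₂ : P2, LinearIndependent ℝ ![v₁, v₂] ∧
      ∃ μ : ℝ, fderiv ℝ S.η p v₂ = μ • fderiv ℝ S.f p v₂ := by
  let φ : P2 →L[ℝ] ℝ :=
    (fderiv ℝ (fderiv ℝ m.N) (S.η p) (fderiv ℝ S.f p v₁)).comp (fderiv ℝ S.f p)
  have hφ₁ : φ v₁ ≠ 0 := by
    refine (hadm.hessian_pos (S.unit_η p hp) (fun h0 => hv₁ ?_) (S.fderiv_N_tangent hp v₁)).ne'
    exact S.immersion p hp (h0.trans (map_zero _).symm)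
  obtain ⟨v₂, hv₂, hv₂0⟩ : ∃ v₂ ∈ (φ : P2 →ₗ[ℝ] ℝ).ker, v₂ ≠ 0 :=
    Submodule.exists_mem_ne_zero_of_ne_bot (LinearMap.ker_ne_bot_of_finrank_lt (by simp))
  have hφ₂ : φ v₂ = 0 := hv₂
  have hli : LinearIndependent ℝ ![v₁, v₂] := by
    refine LinearIndependent.pair_iff.2 fun s t hst => ?_
    have h1 := congrArg φ hst
    simp only [map_add, map_smul, hφ₂, smul_eq_mul, mul_zero, add_zero, map_zero] at h1
    have hs : s = 0 := (mul_eq_zero.1 h1).resolve_right hφ₁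
    subst hs
    rw [zero_smul, zero_add] at hst
    exact ⟨rfl, (smul_eq_zero.1 hst).resolve_right hv₂0⟩
  refine ⟨v₂, hli, ?_⟩
  obtain ⟨u, hu⟩ := S.exists_fderiv_η_eq hp v₂
  have hspan : Submodule.span ℝ (Set.range ![v₁, v₂]) = ⊤ :=
    hli.span_eq_top_of_card_eq_finrank (by simp)
  have hmem : u ∈ Submodule.span ℝ {v₁, v₂} := by
    have : u ∈ Submodule.span ℝ (Set.range ![v₁, v₂]) := hspan ▸ Submodule.mem_top
    rwa [Matrix.range_cons_cons_empty] at this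
  obtain ⟨a, b, rfl⟩ := Submodule.mem_span_pair.1 hmem
  have hφu : φ (a • v₁ + b • v₂) = 0 := by
    change fderiv ℝ (fderiv ℝ m.N) (S.η p) (fderiv ℝ S.f p v₁) (fderiv ℝ S.f p _) = 0
    rw [← hu, m.hessian_symm (S.η_ne_zero hp), S.hessian_fderiv_η_comm hp, hη]
    simp
  simp only [map_add, map_smul, hφ₂, smul_eq_mul, mul_zero, add_zero] at hφu
  have ha : a = 0 := (mul_eq_zero.1 hφu).resolve_right hφ₁
  exact ⟨b, by rw [hu, ha]; simp⟩

end BSurface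

/-- For an admissible norm: if the affine fundamental form `h`
has rank `0` at `p`, then `dη_p = 0`; if it has rank `1` at `p`, then `dη_p`
has two linearly independent eigenvectors, one of them with eigenvalue `0`. -/
theorem rank_zero_or_one (m : MinkowskiNorm3) (hadm : m.Admissible)
    (S : BSurface m) (p : P2) (hp : p ∈ S.U) (h : P2 → P2 → ℝ)
    (hh : S.IsAffineFundForm p h) :
    ((∀ v w : P2, h v w = 0) → ∀ v : P2, fderiv ℝ S.η p v = 0) ∧
    (((¬ ∀ v w : P2, h v w = 0) ∧ ∃ v : P2, v ≠ 0 ∧ ∀ w : P2, h v w = 0) →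
      ∃ v₁ v₂ : P2, LinearIndependent ℝ ![v₁, v₂] ∧
        fderiv ℝ S.η p v₁ = (0 : ℝ) • fderiv ℝ S.f p v₁ ∧
        ∃ μ : ℝ, fderiv ℝ S.η p v₂ = μ • fderiv ℝ S.f p v₂) := by
  refine ⟨fun h0 v => hh.fderiv_η_eq_zero hadm hp (h0 v), ?_⟩
  rintro ⟨-, v₁, hv₁, h₁⟩
  have hη := hh.fderiv_η_eq_zero hadm hp h₁
  obtain ⟨v₂, hli, hμ⟩ := S.exists_eigenvector hadm hp hv₁ hη
  exact ⟨v₁, v₂, hli, by rw [hη, zero_smul], hμ⟩
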